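/- Let G be a VZ(S)-group for a supercharacter theory S, and let σ be a non-linear S-character corresponding to the part X of Irr(G). Then σ(1)² = ‖X‖² · |G : Z(S)|, where ‖X‖² = Σ_{χ∈X} χ(1)². -/

import Mathlib

open scoped BigOperators Pointwise

/-- `f : G → ℂ` is an irreducible character of `G`. -/
def IsIrrChar (G : Type) [Group G] [Fintype G] (f : G → ℂ) : Prop :=
  ∃ V : FDRep ℂ G, CategoryTheory.Simple V ∧ V.character = f

/-- A supercharacter theory of a finite group `G` (Diaconis–Isaacs): a partition
`parts` of the set of irreducible characters of `G` together with a partition of `G`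
into `S`-classes (`cls g` is the class of `g`), such that `{1}` is a class, the number
of parts equals the number of classes, and each supercharacter
`σ_X = ∑ χ ∈ X, χ(1)·χ` is constant on every class. -/
structure SCT (G : Type) [Group G] [Fintype G] where
  parts : Finset (Finset (G → ℂ))
  cls : G → Set G
  parts_cover : ∀ f : G → ℂ, IsIrrChar G f ↔ ∃ X ∈ parts, f ∈ X
  parts_disj : ∀ X ∈ parts, ∀ Y ∈ parts, X ≠ Y → Disjoint X Y
  parts_nonempty : ∀ X ∈ parts, X.Nonempty
  mem_cls : ∀ g : G, g ∈ cls g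
  cls_eq : ∀ g h : G, h ∈ cls g → cls h = cls g
  cls_one : cls (1 : G) = {1}
  card_eq : parts.card = Nat.card (Set.range cls)
  const : ∀ X ∈ parts, ∀ g h : G, h ∈ cls g →
    (∑ χ ∈ X, χ 1 * χ h) = (∑ χ ∈ X, χ 1 * χ g)

variable {G : Type} [Group G] [Fintype G]

namespace SCT

/-- The supercharacter attached to a part `X`. -/
noncomputable def superchar (_S : SCT G) (X : Finset (G → ℂ)) : G → ℂ := fun g => ∑ χ ∈ X, χ 1 * χ g

/-- The set `Irr(S)` of `S`-characters. -/
def Irr (S : SCT G) : Set (G → ℂ) := {f | ∃ X ∈ S.parts, f = S.superchar X}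

end SCT

/-- The kernel of a character-like function `f : G → ℂ`. -/
def charKer (f : G → ℂ) : Subgroup G where
  carrier := {g | ∀ h, f (g * h) = f h}
  one_mem' := by intro h; simp
  mul_mem' := by intro a b ha hb h; rw [mul_assoc, ha, hb]
  inv_mem' := by
    intro a ha h
    have := ha (a⁻¹ * h)
    rw [mul_inv_cancel_left] at this
    exact this.symm

namespace SCT

/-- `[H,S]`, the subgroup generated by the `g⁻¹k` with `g ∈ H`, `k ∈ Cl_S(g)`. -/
def comm (S : SCT G) (H : Subgroup G) : Subgroup G :=
  Subgroup.closure {x | ∃ g ∈ H, ∃ k ∈ S.cls g, x = g⁻¹ * k}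

/-- `[G,S]`. -/
def derived (S : SCT G) : Subgroup G := S.comm ⊤

/-- `Irr(S | N)`: the `S`-characters whose kernel does not contain `N`. -/
def IrrRel (S : SCT G) (N : Subgroup G) : Set (G → ℂ) :=
  {f | f ∈ S.Irr ∧ ¬ N ≤ charKer f}

/-- `g` is an `S`-Camina element: all of `Irr(S | [G,S])` vanishes at `g`. -/
def IsCaminaElt (S : SCT G) (g : G) : Prop :=
  ∀ f ∈ S.IrrRel S.derived, f g = 0

/-- `N` is `S`-normal: a union of `S`-classes. -/
def IsNormal (S : SCT G) (N : Subgroup G) : Prop :=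
  ∀ g ∈ N, S.cls g ⊆ N

/-- `(G,N)` is a generalised `S`-Camina pair. -/
def IsGCP (S : SCT G) (N : Subgroup G) : Prop :=
  S.IsNormal N ∧ ∀ g : G, g ∉ N → S.IsCaminaElt g

/-- The set `Z(S)` of elements with singleton `S`-class. -/
def centerSet (S : SCT G) : Set G := {g | S.cls g = {g}}

/-- The vanishing-off subgroup `V(S | N)`. -/
def V (S : SCT G) (N : Subgroup G) : Subgroup G :=
  Subgroup.closure {g | ∃ f ∈ S.IrrRel N, f g ≠ 0}

/-- `V(S) = V(S | [G,S])`. -/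
def VS (S : SCT G) : Subgroup G := S.V S.derived

/-- `U(S | N)`: the product of all `S`-normal subgroups `H` with `V(S | H) ≤ N`. -/
def U (S : SCT G) (N : Subgroup G) : Subgroup G :=
  ⨆ (H : Subgroup G) (_ : S.IsNormal H ∧ S.V H ≤ N), H

/-- The upper `S`-central series: `ζ_0 = 1` and `ζ_{i+1}/ζ_i = Z(S^{G/ζ_i})`,
i.e. `ζ_{i+1}` consists of the `g` whose `S`-class maps onto the single coset `gζ_i`. -/
def zeta (S : SCT G) : ℕ → Subgroup G
  | 0 => ⊥
  | i + 1 => Subgroup.closure {g | ∀ k ∈ S.cls g, g⁻¹ * k ∈ S.zeta i}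

/-- The lower `S`-central series `γ_1 = G`, `γ_{i+1} = [γ_i, S]` (with `γ_0 := G`). -/
def gamma (S : SCT G) : ℕ → Subgroup G
  | 0 => ⊤
  | 1 => ⊤
  | n + 2 => S.comm (S.gamma (n + 1))

/-- The series `V_1(S) = V(S)`, `V_{i+1}(S) = [V_i(S), S]` (with `V_0 := V(S)`). -/
def Vseq (S : SCT G) : ℕ → Subgroup G
  | 0 => S.VS
  | 1 => S.VS
  | n + 2 => S.comm (S.Vseq (n + 1))

/-- `G` is a `VZ(S)`-group: every member of `Irr(S | [G,S])` vanishes off `Z(S)`. -/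
def IsVZ (S : SCT G) : Prop :=
  ∀ f ∈ S.IrrRel S.derived, ∀ g : G, g ∉ S.centerSet → f g = 0

end SCT

namespace IsIrrChar

theorem sum_mul_inv {f f' : G → ℂ} (hf : IsIrrChar G f) (hf' : IsIrrChar G f') [Decidable (f = f')] :
    ∑ g, f g * f' g⁻¹ = if f = f' then (Fintype.card G : ℂ) else 0 := by
  obtain ⟨V, hV, rfl⟩ := hf
  obtain ⟨W, hW, rfl⟩ := hf'
  have hG : (Nat.card G : ℂ) ≠ 0 := by simp
  let _ : Invertible (Nat.card G : ℂ) := invertibleOfNonzero hG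
  rw [← Nat.card_eq_fintype_card]
  split_ifs with h
  · have := FDRep.char_orthonormal V V
    rw [if_pos ⟨CategoryTheory.Iso.refl V⟩, inv_mul_eq_iff_eq_mul₀ hG, mul_one] at this
    rwa [← h]
  · have := FDRep.char_orthonormal V W
    rw [if_neg fun ⟨i⟩ => h (FDRep.char_iso i), inv_mul_eq_iff_eq_mul₀ hG, mul_zero] at this
    exact this

theorem conj {f : G → ℂ} (hf : IsIrrChar G f) (g h : G) : f (h * g * h⁻¹) = f g := by
  obtain ⟨V, -, rfl⟩ := hf
  exact FDRep.char_conj V g h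

theorem exists_map_mul_of_mem_center {f : G → ℂ} (hf : IsIrrChar G f) {z : G}
    (hz : z ∈ Subgroup.center G) : ∃ c : ℂ, ∀ g, f (z * g) = c * f g := by
  obtain ⟨V, hV, rfl⟩ := hf
  let φ : V ⟶ V := ⟨Action.ρ V z, fun g => by
    change Action.ρ V z * Action.ρ V g = Action.ρ V g * Action.ρ V z
    rw [← map_mul, ← map_mul, Subgroup.mem_center_iff.mp hz g]⟩
  obtain ⟨c, hc⟩ := CategoryTheory.endomorphism_simple_eq_smul_id ℂ φ
  have hρ : V.ρ z = c • LinearMap.id := by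
    have := congrArg (fun ψ : V ⟶ V => ψ.hom.hom.hom) hc
    exact this.symm
  refine ⟨c, fun g => ?_⟩
  rw [FDRep.character, FDRep.character, map_mul, hρ, ← smul_eq_mul c, ← map_smul]
  rfl

theorem apply_one_ne_zero {f : G → ℂ} (hf : IsIrrChar G f) : f 1 ≠ 0 := by
  intro h0
  have h := hf.sum_mul_inv hf
  obtain ⟨V, -, rfl⟩ := hf
  rw [FDRep.char_one, Nat.cast_eq_zero, Module.finrank_zero_iff] at h0
  simp only [FDRep.character, Subsingleton.elim (V.ρ _) 0, map_zero, mul_zero,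
    Finset.sum_const_zero, if_true] at h
  exact Nat.cast_ne_zero.mpr Fintype.card_ne_zero h.symm

theorem mul_apply_inv_of_mem_center {f : G → ℂ} (hf : IsIrrChar G f) {z : G}
    (hz : z ∈ Subgroup.center G) : f z * f z⁻¹ = f 1 ^ 2 := by
  obtain ⟨c, hc⟩ := hf.exists_map_mul_of_mem_center hz
  have h1 := hc 1
  have h2 := hc z⁻¹
  rw [mul_one] at h1
  rw [mul_inv_cancel] at h2
  rw [h1, sq]
  nth_rw 3 [h2]
  ring

end IsIrrChar

namespace SCT

variable (S : SCT G) {X : Finset (G → ℂ)}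

theorem isIrrChar_of_mem (hX : X ∈ S.parts) {f : G → ℂ} (hf : f ∈ X) : IsIrrChar G f :=
  (S.parts_cover f).mpr ⟨X, hX, hf⟩

open scoped Classical in
theorem sum_superchar_mul_inv (hX : X ∈ S.parts) {f : G → ℂ} (hf : IsIrrChar G f) :
    ∑ g, S.superchar X g * f g⁻¹ = if f ∈ X then f 1 * Fintype.card G else 0 := by
  calc ∑ g, S.superchar X g * f g⁻¹ = ∑ χ ∈ X, χ 1 * ∑ g, χ g * f g⁻¹ := by
        simp only [superchar, Finset.sum_mul, Finset.mul_sum]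
        rw [Finset.sum_comm]
        simp only [mul_assoc]
    _ = ∑ χ ∈ X, if χ = f then f 1 * Fintype.card G else 0 := by
        refine Finset.sum_congr rfl fun χ hχ => ?_
        rw [(S.isIrrChar_of_mem hX hχ).sum_mul_inv hf]
        split_ifs with h <;> simp [h]
    _ = _ := by simp

theorem sum_superchar_mul_superchar_inv (hX : X ∈ S.parts) :
    ∑ g, S.superchar X g * S.superchar X g⁻¹ = (∑ χ ∈ X, χ 1 ^ 2) * Fintype.card G := by
  classical
  calc ∑ g, S.superchar X g * S.superchar X g⁻¹
      = ∑ χ ∈ X, χ 1 * ∑ g, S.superchar X g * χ g⁻¹ := by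
        simp only [Finset.mul_sum]
        rw [Finset.sum_comm]
        refine Finset.sum_congr rfl fun g _ => ?_
        rw [superchar, superchar, Finset.mul_sum]
        exact Finset.sum_congr rfl fun χ _ => by ring
    _ = _ := by
        rw [Finset.sum_mul]
        refine Finset.sum_congr rfl fun χ hχ => ?_
        rw [S.sum_superchar_mul_inv hX (S.isIrrChar_of_mem hX hχ), if_pos hχ]
        ring

theorem sum_linearCombination_mul_inv (a : S.parts → ℂ) (hX : X ∈ S.parts) {f : G → ℂ}
    (hf : f ∈ X) :
    ∑ g, (∑ Y : S.parts, a Y * S.superchar Y g) * f g⁻¹ =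
      a ⟨X, hX⟩ * (f 1 * Fintype.card G) := by
  classical
  calc ∑ g, (∑ Y : S.parts, a Y * S.superchar Y g) * f g⁻¹
      = ∑ Y : S.parts, a Y * ∑ g, S.superchar Y g * f g⁻¹ := by
        simp only [Finset.sum_mul, Finset.mul_sum]
        rw [Finset.sum_comm]
        simp only [mul_assoc]
    _ = ∑ Y : S.parts, if Y = ⟨X, hX⟩ then a ⟨X, hX⟩ * (f 1 * Fintype.card G) else 0 := by
        refine Finset.sum_congr rfl fun Y _ => ?_
        rw [S.sum_superchar_mul_inv Y.2 (S.isIrrChar_of_mem hX hf)]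
        by_cases hY : Y = ⟨X, hX⟩
        · subst hY
          simp [hf]
        · have : f ∉ Y.1 := fun h => Finset.disjoint_left.mp
            (S.parts_disj Y Y.2 X hX fun e => hY (Subtype.ext e)) h hf
          simp [hY, this]
    _ = _ := by simp

/-- Functions constant on the `S`-classes are linear combinations of the supercharacters. -/
theorem exists_eq_sum_superchar (F : G → ℂ) (hF : ∀ g, ∀ h ∈ S.cls g, F h = F g) :
    ∃ a : S.parts → ℂ, ∀ g, F g = ∑ X : S.parts, a X * S.superchar X g := by
  classical
  let b : S.parts → Set.range S.cls → ℂ := fun X K => S.superchar X K.2.choose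
  have rep (F : G → ℂ) (hF : ∀ g, ∀ h ∈ S.cls g, F h = F g) (g : G) :
      F (Set.mem_range_self (f := S.cls) g).choose = F g := by
    refine hF g _ ?_
    have := S.mem_cls (Set.mem_range_self (f := S.cls) g).choose
    rwa [(Set.mem_range_self (f := S.cls) g).choose_spec] at this
  have hb (X : S.parts) (g : G) : b X ⟨S.cls g, g, rfl⟩ = S.superchar X g :=
    rep (S.superchar X) (fun g h hh => S.const X X.2 g h hh) g
  have hli : LinearIndependent ℂ b := by
    rw [Fintype.linearIndependent_iff]
    intro a ha X
    obtain ⟨f, hf⟩ := S.parts_nonempty X X.2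
    have hsum := S.sum_linearCombination_mul_inv a X.2 hf
    have h0 (g : G) : ∑ Y : S.parts, a Y * S.superchar Y g = 0 := by
      have := congrFun ha ⟨S.cls g, g, rfl⟩
      simpa [hb] using this
    simp only [h0, zero_mul, Finset.sum_const_zero] at hsum
    simpa [(S.isIrrChar_of_mem X.2 hf).apply_one_ne_zero] using hsum.symm
  have hspan := hli.span_eq_top_of_card_eq_finrank' (by
    rw [Module.finrank_fintype_fun_eq_card, Fintype.card_coe, S.card_eq,
      Nat.card_eq_fintype_card])
  have hmem : (fun K : Set.range S.cls => F K.2.choose) ∈ Submodule.span ℂ (Set.range b) :=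
    hspan ▸ Submodule.mem_top
  obtain ⟨a, ha⟩ := (Submodule.mem_span_range_iff_exists_fun ℂ).mp hmem
  refine ⟨a, fun g => ?_⟩
  have := congrFun ha ⟨S.cls g, g, rfl⟩
  simp only [Finset.sum_apply, Pi.smul_apply, smul_eq_mul, hb] at this
  rw [this, rep F hF]

open scoped Classical in
theorem exists_indicator_eq_sum_superchar {z : G} (hz : z ∈ S.centerSet) :
    ∃ a : S.parts → ℂ, ∀ g, (if g = z then 1 else 0) = ∑ X : S.parts, a X * S.superchar X g := by
  refine S.exists_eq_sum_superchar (fun g => if g = z then 1 else 0) fun g h hh => ?_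
  have hcls : S.cls z = {z} := hz
  have : h = z ↔ g = z := by
    have hgh := S.cls_eq g h hh
    constructor <;> rintro rfl
    · simpa [← hgh, hcls] using S.mem_cls g
    · simpa [hcls] using hh
  simp only [this]

theorem superchar_conj (hX : X ∈ S.parts) (g h : G) :
    S.superchar X (h * g * h⁻¹) = S.superchar X g :=
  Finset.sum_congr rfl fun χ hχ => by rw [(S.isIrrChar_of_mem hX hχ).conj]

theorem centerSet_subset_center : S.centerSet ⊆ Subgroup.center G := by
  classical
  intro z hz
  obtain ⟨a, ha⟩ := S.exists_indicator_eq_sum_superchar hz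
  refine Subgroup.mem_center_iff.mpr fun g => ?_
  have h : (if g * z * g⁻¹ = z then (1 : ℂ) else 0) = if z = z then 1 else 0 := by
    rw [ha, ha]
    exact Finset.sum_congr rfl fun X _ => by rw [S.superchar_conj X.2]
  by_contra hne
  rw [if_neg fun e => hne (mul_inv_eq_iff_eq_mul.mp e)] at h
  simp at h

theorem exists_apply_inv_eq_of_mem_centerSet (hX : X ∈ S.parts) {z : G} (hz : z ∈ S.centerSet) :
    ∃ b : ℂ, ∀ χ ∈ X, χ z⁻¹ = b * χ 1 := by
  classical
  obtain ⟨a, ha⟩ := S.exists_indicator_eq_sum_superchar hz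
  refine ⟨a ⟨X, hX⟩ * Fintype.card G, fun χ hχ => ?_⟩
  have := S.sum_linearCombination_mul_inv a hX hχ
  simp only [← ha, ite_mul, one_mul, zero_mul, Finset.sum_ite_eq', Finset.mem_univ, if_true] at this
  rw [this]
  ring

theorem superchar_mul_inv_of_mem_centerSet (hX : X ∈ S.parts) {z : G} (hz : z ∈ S.centerSet) :
    S.superchar X z * S.superchar X z⁻¹ = S.superchar X 1 ^ 2 := by
  obtain ⟨b, hb⟩ := S.exists_apply_inv_eq_of_mem_centerSet hX hz
  have h1 : S.superchar X z⁻¹ = b * S.superchar X 1 := by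
    rw [superchar, superchar, Finset.mul_sum]
    exact Finset.sum_congr rfl fun χ hχ => by rw [hb χ hχ]; ring
  have h2 : b * S.superchar X z = S.superchar X 1 := by
    rw [superchar, superchar, Finset.mul_sum]
    refine Finset.sum_congr rfl fun χ hχ => ?_
    have := (S.isIrrChar_of_mem hX hχ).mul_apply_inv_of_mem_center (S.centerSet_subset_center hz)
    rw [hb χ hχ] at this
    linear_combination this
  rw [h1]
  linear_combination S.superchar X 1 * h2

end SCT

/-- in a `VZ(S)`-group, a non-linear `S`-character `σ_X` satisfies
`σ_X(1)² = ‖X‖² · |G : Z(S)|`, where `‖X‖² = ∑_{χ ∈ X} χ(1)²`. -/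
theorem isVZ_superchar_degree (S : SCT G) (h : S.IsVZ) (X : Finset (G → ℂ))
    (hX : X ∈ S.parts) (hnl : ¬ S.derived ≤ charKer (S.superchar X)) :
    (S.superchar X 1) ^ 2 =
      (∑ χ ∈ X, (χ 1) ^ 2) * ((Fintype.card G : ℂ) / (Nat.card S.centerSet : ℂ)) := by
  classical
  have hcard : (Nat.card S.centerSet : ℂ) ≠ 0 := by
    have : Nonempty S.centerSet := ⟨⟨1, S.cls_one⟩⟩
    exact Nat.cast_ne_zero.mpr Nat.card_pos.ne'
  rw [mul_div_assoc', eq_div_iff hcard, ← S.sum_superchar_mul_superchar_inv hX]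
  have hterm (g : G) : S.superchar X g * S.superchar X g⁻¹ =
      if g ∈ S.centerSet then S.superchar X 1 ^ 2 else 0 := by
    split_ifs with hg
    · exact S.superchar_mul_inv_of_mem_centerSet hX hg
    · rw [h _ ⟨⟨X, hX, rfl⟩, hnl⟩ g hg, zero_mul]
  simp only [hterm, ← Finset.sum_filter, Finset.sum_const, nsmul_eq_mul]
  rw [Nat.card_eq_fintype_card, Fintype.card_subtype, mul_comm]
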